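/- Let G and G' be graphs whose augmented adjacency matrices have the circular-ones property (Γ circular-arc graphs). Then G and G' are isomorphic if and only if their augmented adjacency matrices are isomorphic as binary matrices. -/

import Mathlib

/-- `M` has the circular-ones property. -/
def HasCircularOnes {ρ γ : Type*} (M : ρ → γ → Prop) : Prop :=
  ∃ (n : ℕ) (σ : γ ≃ Fin n), ∀ r, ∃ a l : ℕ,
    ∀ c, M r c ↔ ∃ j < l, (σ c : ℕ) = (a + j) % n

/-- `a`, `b`, `c` are distinct and appear in this cyclic order. -/
def Cyc (a b c : ℕ) : Prop :=
  (a < b ∧ b < c) ∨ (b < c ∧ c < a) ∨ (c < a ∧ a < b)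

/-- The chords `{a, b}` and `{c, d}` of the circle cross. -/
def Cross (a b c d : ℕ) : Prop :=
  c ≠ a ∧ c ≠ b ∧ d ≠ a ∧ d ≠ b ∧
    ((min a b < c ∧ c < max a b) ↔ ¬ (min a b < d ∧ d < max a b))

theorem cross_iff_cyc {a b c d : ℕ} :
    Cross a b c d ↔ (Cyc a c b ∧ Cyc b d a) ∨ (Cyc a d b ∧ Cyc b c a) := by
  unfold Cross Cyc; omega

theorem Cross.symm {a b c d : ℕ} (h : Cross a b c d) : Cross c d a b := by
  unfold Cross at *; omega

theorem Cross.right {a b c d : ℕ} (h : Cross a b c d) : Cross a b d c := by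
  unfold Cross at *; omega

theorem Cross.left {a b c d : ℕ} (h : Cross a b c d) : Cross b a c d := by
  unfold Cross at *; omega

theorem Cross.trans_not {a b c d e : ℕ} (h : Cross a b c d) (he : ¬ Cross a b d e)
    (hea : e ≠ a) (heb : e ≠ b) : Cross a b c e := by
  unfold Cross at *; omega

/-- No two points of an arc of the integers modulo `n` are separated by two points outside. -/
theorem not_cross_of_mod {n a l x y z w : ℕ} (hz : z < n) (hw : w < n)
    (hx : ∃ j < l, x = (a + j) % n) (hy : ∃ j < l, y = (a + j) % n)
    (hz' : ¬ ∃ j < l, z = (a + j) % n) (hw' : ¬ ∃ j < l, w = (a + j) % n) :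
    ¬ Cross x y z w := by
  have hn : 0 < n := by omega
  have red : ∀ j, ∃ j' ≤ j, j' < n ∧
      ((a + j) % n = a % n + j' ∨ (a + j) % n + n = a % n + j') := by
    intro j
    refine ⟨j % n, Nat.mod_le _ _, Nat.mod_lt _ hn, ?_⟩
    rw [Nat.add_mod]
    have h1 := Nat.mod_lt a hn
    have h2 := Nat.mod_lt j hn
    rcases lt_or_ge (a % n + j % n) n with h | h
    · left; exact Nat.mod_eq_of_lt h
    · right
      rw [Nat.mod_eq_sub_mod h, Nat.mod_eq_of_lt (by omega)]; omega
  have idx : ∀ t < n, (¬ ∃ j < l, t = (a + j) % n) → ∃ j < n, l ≤ j ∧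
      (t = a % n + j ∨ t + n = a % n + j) := by
    intro t ht hnot
    have h1 := Nat.mod_lt a hn
    have key : ∃ j < n, (t = a % n + j ∨ t + n = a % n + j) := by
      rcases lt_or_ge t (a % n) with h | h
      · exact ⟨t + n - a % n, by omega, by omega⟩
      · exact ⟨t - a % n, by omega, by omega⟩
    obtain ⟨j, hj, hjt⟩ := key
    refine ⟨j, hj, ?_, hjt⟩
    by_contra hlt
    refine hnot ⟨j, by omega, ?_⟩
    rw [Nat.add_mod, Nat.mod_eq_of_lt hj]
    rcases hjt with h | h
    · rw [← h, Nat.mod_eq_of_lt ht]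
    · rw [← h, Nat.add_mod_right, Nat.mod_eq_of_lt ht]
  obtain ⟨jx, hjx, rfl⟩ := hx
  obtain ⟨jy, hjy, rfl⟩ := hy
  obtain ⟨jz, hjz, hlz, ez⟩ := idx z hz hz'
  obtain ⟨jw, hjw, hlw, ew⟩ := idx w hw hw'
  obtain ⟨jx', h1, h2, ex⟩ := red jx
  obtain ⟨jy', h3, h4, ey⟩ := red jy
  have h5 := Nat.mod_lt a hn
  generalize (a + jx) % n = x at *
  generalize (a + jy) % n = y at *
  generalize a % n = a at *
  clear hz' hw' idx red
  unfold Cross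
  rcases ex with ex | ex <;> rcases ey with ey | ey <;> rcases ez with ez | ez <;>
    rcases ew with ew | ew <;> omega

/-- A symmetric irreflexive relation on points of a circle (`f` gives their positions) all of
whose neighbourhoods are arcs. -/
structure IsArcRelation {V : Type*} (f : V → ℕ) (F : V → V → Prop) : Prop where
  inj : Function.Injective f
  symm : ∀ {u v}, F u v → F v u
  irrefl : ∀ u, ¬ F u u
  arc : ∀ {u x y z w}, F u x → F u y → ¬ F u z → ¬ F u w → ¬ Cross (f x) (f y) (f z) (f w)

/-- Reachability by walks of even length. -/
def EvenReach {V : Type*} (F : V → V → Prop) : V → V → Prop :=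
  Relation.ReflTransGen fun u v => ∃ w, F u w ∧ F w v

namespace EvenReach

variable {V : Type*} {F : V → V → Prop}

theorem symm (hF : ∀ {u v}, F u v → F v u) {u v : V} (h : EvenReach F u v) :
    EvenReach F v u := by
  induction h with
  | refl => exact .refl
  | tail _ h ih =>
    obtain ⟨w, h1, h2⟩ := h
    exact .head ⟨w, hF h2, hF h1⟩ ih

theorem of_adj (hF : ∀ {u v}, F u v → F v u) {u u' v v' : V} (h : EvenReach F u u')
    (huv : F u v) (huv' : F u' v') : EvenReach F v v' := by
  induction h generalizing v' with
  | refl => exact .single ⟨_, hF huv, huv'⟩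
  | tail _ h ih =>
    obtain ⟨w, h1, h2⟩ := h
    exact .tail (ih h1) ⟨_, h2, huv'⟩

/-- A partial proper two-colouring closed under adjacency excludes odd closed walks. -/
theorem not_of_coloring {red blue : V → Prop} (hrb : ∀ {u v}, red u → F u v → blue v)
    (hbr : ∀ {u v}, blue u → F u v → red v) (hdisj : ∀ {u v}, F u v → red u → ¬ blue u)
    (hF : ∀ {u v}, F u v → F v u) {u v : V} (hu : red u) (huv : F u v) :
    ¬ EvenReach F u v := by
  intro h
  have key : red v := by
    clear huv
    induction h with
    | refl => exact hu
    | tail _ h ih =>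
      obtain ⟨w, h1, h2⟩ := h
      exact hbr (hrb ih h1) h2
  exact hdisj (hF huv) key (hrb hu huv)

end EvenReach

namespace IsArcRelation

variable {V : Type*} {f : V → ℕ} {F : V → V → Prop}

/-- An odd closed walk forces the relation to be connected by even walks. -/
theorem evenReach_of_odd (h : IsArcRelation f F) {u v : V} (huv : F u v)
    (he : EvenReach F u v) (p : V) : EvenReach F u p := by
  by_contra hp
  have cl : ∀ {z x}, EvenReach F u z → F z x → EvenReach F u x := fun hz hx =>
    he.trans (hz.of_adj h.symm huv hx)
  have side : ∀ {z x y}, EvenReach F u z → F z x → F z y →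
      Cyc (f p) (f z) (f x) → Cyc (f p) (f z) (f y) := by
    intro z x y hz hx hy hc
    have hyp : f y ≠ f p := fun e => hp (h.inj e ▸ cl hz hy)
    have hyz : f y ≠ f z := fun e => h.irrefl z (by rwa [h.inj e] at hy)
    have hzp : ¬ F z p := fun e => hp (cl hz e)
    have := h.arc hx hy (h.irrefl z) hzp
    unfold Cyc at *; unfold Cross at this; omega
  have side' : ∀ {z x}, EvenReach F u z → F z x →
      Cyc (f p) (f z) (f x) ∨ Cyc (f p) (f x) (f z) := by
    intro z x hz hx
    have h1 : f x ≠ f p := fun e => hp (h.inj e ▸ cl hz hx)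
    have h2 : f z ≠ f p := fun e => hp (h.inj e ▸ hz)
    have h3 : f x ≠ f z := fun e => h.irrefl z (by rwa [h.inj e] at hx)
    unfold Cyc; omega
  have excl : ∀ {a b : ℕ}, Cyc (f p) a b → ¬ Cyc (f p) b a := by
    intro a b; unfold Cyc; omega
  let hi : V → Prop := fun z => EvenReach F u z ∧ ∀ x, F z x → Cyc (f p) (f z) (f x)
  let lo : V → Prop := fun z => EvenReach F u z ∧ ∀ x, F z x → Cyc (f p) (f x) (f z)
  have hl : ∀ {z x}, hi z → F z x → lo x := by
    rintro z x ⟨hz, hz'⟩ hx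
    refine ⟨cl hz hx, fun y hy => (side' (cl hz hx) hy).resolve_left fun hc => ?_⟩
    exact excl (hz' x hx) (side (cl hz hx) hy (h.symm hx) hc)
  have lh : ∀ {z x}, lo z → F z x → hi x := by
    rintro z x ⟨hz, hz'⟩ hx
    refine ⟨cl hz hx, fun y hy => side (cl hz hx) (h.symm hx) hy (hz' x hx)⟩
  have disj : ∀ {z x}, F z x → hi z → ¬ lo z := fun hx h1 h2 => excl (h1.2 _ hx) (h2.2 _ hx)
  rcases side' .refl huv with hc | hc
  · have hu : hi u := ⟨.refl, fun x hx => side .refl huv hx hc⟩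
    exact EvenReach.not_of_coloring (F := F) hl lh disj h.symm hu huv he
  · have hu : lo u := ⟨.refl, fun x hx => (side' .refl hx).resolve_left fun hc' =>
      excl hc (side .refl hx huv hc')⟩
    exact EvenReach.not_of_coloring (F := F) lh hl
      (fun hx h1 h2 => disj hx h2 h1) h.symm hu huv he

end IsArcRelation

/-- An involution `ι` with `F (ι u) v ↔ F u (ι v)` that moves no point to a neighbour. -/
structure IsFlip {V : Type*} (F : V → V → Prop) (ι : V → V) : Prop where
  invol : ∀ u, ι (ι u) = u
  adj : ∀ {u v}, F (ι u) v ↔ F u (ι v)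
  not_adj : ∀ u, ¬ F (ι u) u

/-- A flip of an arc relation for which related points span noncrossing chords. -/
structure IsNoncrossingFlip {V : Type*} (f : V → ℕ) (F : V → V → Prop) (ι : V → V) : Prop
    extends IsArcRelation f F, IsFlip F ι where
  nc : ∀ {v w}, F v w → ¬ Cross (f v) (f (ι v)) (f w) (f (ι w))

/-- The points of the arc between `v` and `ι v` that avoids the neighbours of `v`. -/
def Hull {V : Type*} (f : V → ℕ) (F : V → V → Prop) (ι : V → V) (v p : V) : Prop :=
  p = v ∨ p = ι v ∨ ∃ c, F v c ∧ Cross (f v) (f (ι v)) (f p) (f c)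

/-- `u` distinguishes `v` from `ι v`. -/
def Linked {V : Type*} (F : V → V → Prop) (ι : V → V) (u v : V) : Prop :=
  ¬ (F u v ↔ F u (ι v))

theorem IsArcRelation.pos_ne {V : Type*} {f : V → ℕ} {F : V → V → Prop} (h : IsArcRelation f F)
    {u x y : V} (hx : F u x) (hy : ¬ F u y) : f x ≠ f y :=
  fun e => hy (h.inj e ▸ hx)

namespace IsNoncrossingFlip

variable {V : Type*} {f : V → ℕ} {F : V → V → Prop} {ι : V → V}

theorem adj_flip (h : IsNoncrossingFlip f F ι) {u v : V} : F (ι u) (ι v) ↔ F u v := by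
  rw [h.adj, h.invol]

theorem not_adj' (h : IsNoncrossingFlip f F ι) (u : V) : ¬ F u (ι u) :=
  fun e => h.not_adj u (h.symm e)

theorem linked_flip_right (h : IsNoncrossingFlip f F ι) {u v : V} :
    Linked F ι u (ι v) ↔ Linked F ι u v := by
  unfold Linked; rw [h.invol, iff_comm (a := F u v)]

theorem linked_symm (h : IsNoncrossingFlip f F ι) {u v : V} (huv : Linked F ι u v) :
    Linked F ι v u := by
  have h1 : F v u ↔ F u v := ⟨h.symm, h.symm⟩
  have h2 : F v (ι u) ↔ F u (ι v) := by rw [← h.adj]; exact ⟨h.symm, h.symm⟩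
  unfold Linked at *; rwa [h1, h2]

/-- Orient a link: after possibly flipping `v`, the points `u, v` and `ι u, ι v` are related. -/
theorem linked_cases (h : IsNoncrossingFlip f F ι) {u v : V} (huv : Linked F ι u v) :
    ∃ v', (v' = v ∨ v' = ι v) ∧ F u v' ∧ ¬ F u (ι v') ∧ F (ι u) (ι v') ∧ ¬ F (ι u) v' := by
  unfold Linked at huv
  by_cases h1 : F u v
  · have h2 : ¬ F u (ι v) := by tauto
    exact ⟨v, .inl rfl, h1, h2, h.adj_flip.2 h1, fun e => h2 (h.adj.1 e)⟩
  · have h2 : F u (ι v) := by tauto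
    exact ⟨ι v, .inr rfl, h2, by rwa [h.invol], h.adj_flip.2 h2, fun e => h1 (h.adj_flip.1 e)⟩

theorem cross_congr (h : IsNoncrossingFlip f F ι) {v c d p : V} (hc : F v c) (hd : F v d)
    (hp : Cross (f v) (f (ι v)) (f p) (f c)) : Cross (f v) (f (ι v)) (f p) (f d) :=
  hp.trans_not (fun e => h.arc hc hd (h.irrefl v) (h.not_adj' v) e.symm)
    (h.pos_ne hd (h.irrefl v)) (h.pos_ne hd (h.not_adj' v))

theorem cross_of_hull (h : IsNoncrossingFlip f F ι) {v p d : V} (hp : Hull f F ι v p)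
    (h1 : p ≠ v) (h2 : p ≠ ι v) (hd : F v d) : Cross (f v) (f (ι v)) (f p) (f d) := by
  obtain rfl | rfl | ⟨c, hc, hx⟩ := hp
  · exact absurd rfl h1
  · exact absurd rfl h2
  · exact h.cross_congr hc hd hx

theorem hull_flip_of (h : IsNoncrossingFlip f F ι) {v p : V} (hp : Hull f F ι v p) :
    Hull f F ι (ι v) p := by
  obtain rfl | rfl | ⟨c, hc, hx⟩ := hp
  · exact .inr (.inl (h.invol _).symm)
  · exact .inl rfl
  · refine .inr (.inr ⟨ι c, h.adj_flip.2 hc, ?_⟩)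
    rw [h.invol]
    refine (hx.trans_not (h.nc hc) ?_ ?_).left
    · exact h.pos_ne (h.adj_flip.2 hc) (h.not_adj v)
    · exact h.pos_ne (h.adj_flip.2 hc) (h.irrefl _)

theorem hull_flip (h : IsNoncrossingFlip f F ι) {v p : V} :
    Hull f F ι (ι v) p ↔ Hull f F ι v p :=
  ⟨fun hp => by simpa [h.invol] using h.hull_flip_of hp, h.hull_flip_of⟩

theorem not_adj_of_hull (h : IsNoncrossingFlip f F ι) {v p : V} (hp : Hull f F ι v p) :
    ¬ F v p := by
  obtain rfl | rfl | ⟨c, hc, hx⟩ := hp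
  · exact h.irrefl _
  · exact h.not_adj' _
  · exact fun e => h.arc e hc (h.irrefl v) (h.not_adj' v) hx.symm

theorem not_adj_flip_of_hull (h : IsNoncrossingFlip f F ι) {v p : V} (hp : Hull f F ι v p) :
    ¬ F (ι v) p :=
  h.not_adj_of_hull (h.hull_flip.2 hp)

/-- A point related to neither `v` nor `ι v` has its neighbours inside the hull or outside. -/
theorem hull_of_hull (h : IsNoncrossingFlip f F ι) {v p x y : V} (h1 : ¬ F p v)
    (h2 : ¬ F p (ι v)) (hx : F p x) (hy : F p y) (hxv : Hull f F ι v x) : Hull f F ι v y := by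
  by_contra hyv
  obtain rfl | rfl | ⟨c, hc, hcr⟩ := hxv
  · exact h1 hx
  · exact h2 hx
  · refine h.arc hx hy h1 h2 (Cross.symm (hcr.trans_not ?_ (h.pos_ne hy h1) (h.pos_ne hy h2)))
    exact fun e => hyv (.inr (.inr ⟨c, hc, e.right⟩))

theorem hull_disjoint_of_adj (h : IsNoncrossingFlip f F ι) {v w p : V} (hvw : F v w)
    (hv : Hull f F ι v p) (hw : Hull f F ι w p) : False := by
  have hwv := h.symm hvw
  by_cases h1 : p = v
  · exact h.not_adj_of_hull hw (h1 ▸ hwv)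
  by_cases h2 : p = ι v
  · exact h.not_adj_flip_of_hull hw (h2 ▸ h.adj_flip.2 hwv)
  by_cases h3 : p = w
  · exact h.not_adj_of_hull hv (h3 ▸ hvw)
  by_cases h4 : p = ι w
  · exact h.not_adj_flip_of_hull hv (h4 ▸ h.adj_flip.2 hvw)
  have c1 := h.cross_of_hull hv h1 h2 hvw
  have c2 := h.cross_of_hull hw h3 h4 hwv
  have n1 := h.nc hvw
  have n2 := h.nc hwv
  have e1 := h.pos_ne (h.adj_flip.2 hvw) (h.not_adj v)
  have e2 := h.pos_ne (h.adj_flip.2 hvw) (h.irrefl (ι v))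
  unfold Cross at *; omega

theorem hull_disjoint_of_linked (h : IsNoncrossingFlip f F ι) {v w p : V}
    (hvw : Linked F ι v w) (hv : Hull f F ι v p) (hw : Hull f F ι w p) : False := by
  obtain ⟨w', rfl | rfl, h1, -⟩ := h.linked_cases hvw
  · exact h.hull_disjoint_of_adj h1 hv hw
  · exact h.hull_disjoint_of_adj h1 hv (h.hull_flip.2 hw)

/-- A common neighbour of `x` and `ι x` lies in the hull of every point linked to `x`. -/
theorem hull_of_linked (h : IsNoncrossingFlip f F ι) {x y p : V} (hxy : Linked F ι x y)
    (hp : F x p) (hp' : F (ι x) p) : Hull f F ι y p := by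
  suffices H : ∀ y, F x y → ¬ F x (ι y) → F (ι x) (ι y) → ¬ F (ι x) y → Hull f F ι y p by
    obtain ⟨w', rfl | rfl, h1, h2, h3, h4⟩ := h.linked_cases hxy
    · exact H _ h1 h2 h3 h4
    · exact h.hull_flip.1 (H _ h1 h2 h3 h4)
  intro y h1 h2 h3 h4
  refine .inr (.inr ⟨x, h.symm h1, ?_⟩)
  have a1 := h.arc h1 hp h2 (h.irrefl x)
  have a2 := h.arc h3 hp' h4 (h.not_adj x)
  have e1 := h.pos_ne h1 h2
  have e2 := h.pos_ne h1 (h.irrefl x)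
  have e3 := h.pos_ne h3 (h.not_adj x)
  have e4 := h.pos_ne hp h2
  have e5 := h.pos_ne hp' h4
  have e6 := h.pos_ne hp (h.irrefl x)
  unfold Cross at *; omega

/-- A point in the hull of one point linked to `k` but not in that of another one is
linked to `k`. -/
theorem linked_of_hull_diff (h : IsNoncrossingFlip f F ι) {k j l p : V} (hj : Linked F ι k j)
    (hl : Linked F ι k l) (hpj : Hull f F ι j p) (hpl : ¬ Hull f F ι l p) : Linked F ι k p := by
  suffices H : ∀ j l, F k j → ¬ F k (ι j) → F (ι k) (ι j) → ¬ F (ι k) j →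
      F k l → ¬ F k (ι l) → F (ι k) (ι l) → ¬ F (ι k) l → Hull f F ι j p →
      ¬ Hull f F ι l p → Linked F ι k p by
    obtain ⟨j', hj', a1, a2, a3, a4⟩ := h.linked_cases hj
    obtain ⟨l', hl', b1, b2, b3, b4⟩ := h.linked_cases hl
    refine H j' l' a1 a2 a3 a4 b1 b2 b3 b4 ?_ ?_
    · obtain rfl | rfl := hj'
      exacts [hpj, h.hull_flip.2 hpj]
    · obtain rfl | rfl := hl'
      exacts [hpl, fun e => hpl (h.hull_flip.1 e)]
  intro j l a1 a2 a3 a4 b1 b2 b3 b4 hpj hpl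
  have hlk : Linked F ι k l := fun e => b2 (e.1 b1)
  by_contra hn
  have hkp : F k p ↔ F (ι k) p := by rw [h.adj]; unfold Linked at hn; tauto
  by_cases hp : F k p
  · exact hpl (h.hull_of_linked hlk hp (hkp.1 hp))
  have hp' : ¬ F (ι k) p := fun e => hp (hkp.2 e)
  have n1 : p ≠ j := fun e => hp (e ▸ a1)
  have n2 : p ≠ ι j := fun e => hp' (e ▸ a3)
  have c1 := (h.cross_of_hull hpj n1 n2 (h.symm a1)).symm
  have c2 : ¬ Cross (f p) (f k) (f l) (f (ι l)) :=
    fun e => hpl (.inr (.inr ⟨k, h.symm b1, e.symm⟩))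
  have c3 := h.arc a1 b1 hp (h.irrefl k)
  have c4 := h.arc a3 b3 hp' (h.not_adj k)
  have c5 : Cross (f p) (f k) (f l) (f (ι j)) := by
    have := c1.right.trans_not (e := f l) (fun e => c3 e.symm) (h.pos_ne b1 hp)
      (h.pos_ne b1 (h.irrefl k))
    exact this.right
  exact c2 (c5.trans_not (fun e => c4 e.symm) (h.pos_ne b3 hp') (h.pos_ne b3 (h.not_adj k)))

/-- The hulls of two points linked to a common point meet, an endpoint of one lying in
the other. -/
theorem hull_meet (h : IsNoncrossingFlip f F ι) {k i j : V} (hi : Linked F ι k i)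
    (hj : Linked F ι k j) : ∃ p, Hull f F ι i p ∧ Hull f F ι j p := by
  suffices H : ∀ i j, F k j → ¬ F k (ι j) → F (ι k) (ι j) → ¬ F (ι k) j →
      F k i → ¬ F k (ι i) → F (ι k) (ι i) → ¬ F (ι k) i →
      ∃ p, Hull f F ι i p ∧ Hull f F ι j p by
    obtain ⟨j', hj', a1, a2, a3, a4⟩ := h.linked_cases hj
    obtain ⟨i', hi', b1, b2, b3, b4⟩ := h.linked_cases hi
    obtain ⟨p, p1, p2⟩ := H i' j' a1 a2 a3 a4 b1 b2 b3 b4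
    refine ⟨p, ?_, ?_⟩
    · obtain rfl | rfl := hi'
      exacts [p1, h.hull_flip.1 p1]
    · obtain rfl | rfl := hj'
      exacts [p2, h.hull_flip.1 p2]
  intro i j a1 a2 a3 a4 b1 b2 b3 b4
  by_contra! hn
  have c1 : ¬ Cross (f j) (f (ι j)) (f i) (f k) := fun e =>
    hn i (.inl rfl) (.inr (.inr ⟨k, h.symm a1, e⟩))
  have c2 : ¬ Cross (f j) (f (ι j)) (f (ι i)) (f k) := fun e =>
    hn (ι i) (.inr (.inl rfl)) (.inr (.inr ⟨k, h.symm a1, e⟩))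
  have c3 : ¬ Cross (f i) (f (ι i)) (f j) (f k) := fun e =>
    hn j (.inr (.inr ⟨k, h.symm b1, e⟩)) (.inl rfl)
  have c4 : ¬ Cross (f i) (f (ι i)) (f (ι j)) (f k) := fun e =>
    hn (ι j) (.inr (.inr ⟨k, h.symm b1, e⟩)) (.inr (.inl rfl))
  by_cases hij : i = j
  · subst hij; exact hn i (.inl rfl) (.inl rfl)
  have hij' : f i ≠ f j := fun e => hij (h.inj e)
  have hij'' : f (ι i) ≠ f (ι j) := fun e => hij <| by
    rw [← h.invol i, h.inj e, h.invol]
  have d1 := h.arc a1 b1 a2 (h.irrefl k)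
  have d2 := h.arc a1 b1 b2 (h.irrefl k)
  have d3 := h.arc a3 b3 a4 (h.not_adj k)
  have d4 := h.arc a3 b3 b4 (h.not_adj k)
  have e1 := h.pos_ne a1 a2
  have e2 := h.pos_ne a1 b2
  have e3 := h.pos_ne b1 a2
  have e4 := h.pos_ne b1 b2
  have e5 := h.pos_ne a1 (h.irrefl k)
  have e6 := h.pos_ne b1 (h.irrefl k)
  have e7 := h.pos_ne a3 (h.not_adj k)
  have e8 := h.pos_ne b3 (h.not_adj k)
  unfold Cross at *; omega

end IsNoncrossingFlip

namespace IsNoncrossingFlip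

variable {V : Type*} {f : V → ℕ} {F : V → V → Prop} {ι : V → V}

/-- If a point of one hull lies in another one, but neither of its own ends does, then the second
hull is contained in the first. -/
theorem hull_subset (h : IsNoncrossingFlip f F ι) {i l c p q : V} (hl : F l c)
    (hpi : Hull f F ι i p) (hpl : Hull f F ι l p) (hi : ¬ Hull f F ι l i)
    (hi' : ¬ Hull f F ι l (ι i)) (hq : Hull f F ι l q) : Hull f F ι i q := by
  by_contra hqi
  have hc : ∀ x, Hull f F ι l x → x = l ∨ x = ι l ∨ Cross (f l) (f (ι l)) (f x) (f c) := by
    intro x hx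
    by_cases h1 : x = l
    · exact .inl h1
    by_cases h2 : x = ι l
    · exact .inr (.inl h2)
    exact .inr (.inr (h.cross_of_hull hx h1 h2 hl))
  obtain rfl | rfl | ⟨d, hd, hx⟩ := hpi
  · exact hi hpl
  · exact hi' hpl
  have hpq : Cross (f i) (f (ι i)) (f p) (f q) :=
    hx.trans_not (fun e => hqi (.inr (.inr ⟨d, hd, e.right⟩)))
      (fun e => hi (h.inj e ▸ hq)) (fun e => hi' (h.inj e ▸ hq))
  have n1 : ¬ Cross (f l) (f (ι l)) (f i) (f c) := fun e => hi (.inr (.inr ⟨c, hl, e⟩))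
  have n2 : ¬ Cross (f l) (f (ι l)) (f (ι i)) (f c) := fun e => hi' (.inr (.inr ⟨c, hl, e⟩))
  have e1 : f i ≠ f l := fun e => hi (.inl (h.inj e))
  have e2 : f i ≠ f (ι l) := fun e => hi (.inr (.inl (h.inj e)))
  have e3 : f (ι i) ≠ f l := fun e => hi' (.inl (h.inj e))
  have e4 : f (ι i) ≠ f (ι l) := fun e => hi' (.inr (.inl (h.inj e)))
  have e5 := h.pos_ne hl (h.irrefl l)
  have e6 := h.pos_ne hl (h.not_adj' l)
  obtain rfl | rfl | h1 := hc p hpl <;> obtain rfl | rfl | h2 := hc q hq <;>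
    unfold Cross at * <;> omega

theorem Linked.exists_adj (h : IsNoncrossingFlip f F ι) {u v : V} (huv : Linked F ι u v) :
    ∃ c, F u c := by
  obtain ⟨c, -, hc, -⟩ := h.linked_cases huv
  exact ⟨c, hc⟩

/-- Disjointness from a hull propagates along walks of links of length two. -/
theorem hull_disjoint_trans (h : IsNoncrossingFlip f F ι) {i j k l p : V}
    (hij : ∀ q, Hull f F ι i q → ¬ Hull f F ι j q) (hkj : Linked F ι k j)
    (hkl : Linked F ι k l) : Hull f F ι i p → ¬ Hull f F ι l p := by
  intro hpi hpl
  have hend : ∀ i, (∀ q, Hull f F ι i q → ¬ Hull f F ι j q) → ¬ Hull f F ι l i := by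
    intro i hij hil
    have hki := h.linked_of_hull_diff hkl hkj hil (hij i (.inl rfl))
    obtain ⟨q, h1, h2⟩ := h.hull_meet hki hkj
    exact hij q h1 h2
  obtain ⟨c, hc⟩ := Linked.exists_adj h (h.linked_symm hkl)
  obtain ⟨q, h1, h2⟩ := h.hull_meet hkj hkl
  exact hij q (h.hull_subset hc hpi hpl (hend i hij)
    (hend (ι i) fun q hq => hij q (h.hull_flip.1 hq)) h2) h1

/-- The union of the hulls of the points reached from `a` by even walks of links. -/
def _root_.HullUnion (f : V → ℕ) (F : V → V → Prop) (ι : V → V) (a p : V) : Prop :=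
  ∃ x, EvenReach (Linked F ι) a x ∧ Hull f F ι x p

theorem hull_disjoint_of_evenReach (h : IsNoncrossingFlip f F ι) {i a y : V}
    (hia : ∀ q, Hull f F ι i q → ¬ Hull f F ι a q) (hy : EvenReach (Linked F ι) a y) :
    ∀ q, Hull f F ι i q → ¬ Hull f F ι y q := by
  induction hy with
  | refl => exact hia
  | tail _ hk ih =>
    obtain ⟨k, h1, h2⟩ := hk
    exact fun q => h.hull_disjoint_trans ih (h.linked_symm h1) h2

theorem hullUnion_disjoint (h : IsNoncrossingFlip f F ι) {a b p : V} (hab : Linked F ι a b)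
    (ha : HullUnion f F ι a p) (hb : HullUnion f F ι b p) : False := by
  obtain ⟨x, hx, hpx⟩ := ha
  obtain ⟨y, hy, hpy⟩ := hb
  have h1 := h.hull_disjoint_of_evenReach
    (fun q h1 h2 => h.hull_disjoint_of_linked hab h1 h2) hy
  exact h.hull_disjoint_of_evenReach (fun q h2 h3 => h1 q h3 h2) hx p hpy hpx

theorem exists_linked_of_evenReach (h : IsNoncrossingFlip f F ι) {a b x : V}
    (hab : Linked F ι a b) (hx : EvenReach (Linked F ι) a x) :
    ∃ y, Linked F ι x y ∧ EvenReach (Linked F ι) b y := by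
  obtain ⟨y, hy⟩ : ∃ y, Linked F ι x y := by
    rcases Relation.ReflTransGen.cases_tail hx with rfl | ⟨_, _, w, _, hw⟩
    exacts [⟨b, hab⟩, ⟨w, h.linked_symm hw⟩]
  exact ⟨y, hy, hx.of_adj h.linked_symm hab hy⟩

theorem evenReach_flip (h : IsNoncrossingFlip f F ι) {a b x : V} (hab : Linked F ι a b)
    (hx : EvenReach (Linked F ι) a x) : EvenReach (Linked F ι) a (ι x) := by
  obtain ⟨y, hy, -⟩ := h.exists_linked_of_evenReach hab hx
  exact .tail hx ⟨y, hy, h.linked_flip_right.2 (h.linked_symm hy)⟩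

/-- The neighbours of the points on one side lie in the hull union of the other side. -/
theorem hullUnion_of_adj (h : IsNoncrossingFlip f F ι) {a b x p : V} (hab : Linked F ι a b)
    (hx : EvenReach (Linked F ι) a x) (hp : F x p) : HullUnion f F ι b p := by
  by_cases hl : Linked F ι x p
  · exact ⟨p, hx.of_adj h.linked_symm hab hl, .inl rfl⟩
  · obtain ⟨y, hy, hby⟩ := h.exists_linked_of_evenReach hab hx
    have : F x (ι p) := by unfold Linked at hl; tauto
    exact ⟨y, hby, h.hull_of_linked hy hp (h.adj.2 this)⟩

/-- A point of a hull union that is not itself on the corresponding side lies in all hulls. -/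
theorem hull_of_hullUnion (h : IsNoncrossingFlip f F ι) {a p x : V}
    (hp : HullUnion f F ι a p) (hn : ¬ EvenReach (Linked F ι) a p)
    (hx : EvenReach (Linked F ι) a x) : Hull f F ι x p := by
  obtain ⟨z, hz, hzp⟩ := hp
  have hzx : EvenReach (Linked F ι) z x := (hz.symm h.linked_symm).trans hx
  clear hx
  induction hzx with
  | refl => exact hzp
  | @tail u v h1 h2 ih =>
    obtain ⟨k, h3, h4⟩ := h2
    by_contra hv
    have := h.linked_of_hull_diff (h.linked_symm h3) h4 ih hv
    exact hn ((hz.trans h1).tail ⟨k, h3, this⟩)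

/-- The neighbours of a point of a hull union lie all inside or all outside the union. -/
theorem hullUnion_of_hullUnion (h : IsNoncrossingFlip f F ι) {a b v p q : V}
    (hab : Linked F ι a b) (hv : HullUnion f F ι a v) (hp : F v p) (hq : F v q)
    (hpa : HullUnion f F ι a p) : HullUnion f F ι a q := by
  by_cases hva : EvenReach (Linked F ι) a v
  · exact (h.hullUnion_disjoint hab hpa (h.hullUnion_of_adj hab hva hp)).elim
  · obtain ⟨x, hx, hxp⟩ := hpa
    have hvx := h.hull_of_hullUnion hv hva hx
    exact ⟨x, hx, h.hull_of_hull (fun e => h.not_adj_of_hull hvx (h.symm e))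
      (fun e => h.not_adj_flip_of_hull hvx (h.symm e)) hp hq hxp⟩

/-- The neighbours of a point outside both hull unions lie inside or outside a given one. -/
theorem hullUnion_of_not_hullUnion (h : IsNoncrossingFlip f F ι) {a b v p q : V}
    (hab : Linked F ι a b) (hv : ¬ HullUnion f F ι b v) (hp : F v p) (hq : F v q)
    (hpa : HullUnion f F ι a p) : HullUnion f F ι a q := by
  obtain ⟨x, hx, hxp⟩ := hpa
  exact ⟨x, hx, h.hull_of_hull (fun e => hv (h.hullUnion_of_adj hab hx (h.symm e)))
    (fun e => hv (h.hullUnion_of_adj hab (h.evenReach_flip hab hx) (h.symm e))) hp hq hxp⟩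

/-- The colour class of the partial two-colouring determined by the sides `a` and `b`. -/
def _root_.HullColor (f : V → ℕ) (F : V → V → Prop) (ι : V → V) (a b v : V) : Prop :=
  (HullUnion f F ι a v ∧ ∀ p, F v p → ¬ HullUnion f F ι a p) ∨
    (¬ HullUnion f F ι a v ∧ ¬ HullUnion f F ι b v ∧ ∀ p, F v p → HullUnion f F ι b p)

theorem hullColor_of_adj (h : IsNoncrossingFlip f F ι) {a b v w : V} (hab : Linked F ι a b)
    (hv : HullColor f F ι a b v) (hvw : F v w) : HullColor f F ι b a w := by
  have hba := h.linked_symm hab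
  have hwv := h.symm hvw
  rcases hv with ⟨h1, h2⟩ | ⟨h1, h2, h3⟩
  · have hw := h2 w hvw
    by_cases hwb : HullUnion f F ι b w
    · exact .inl ⟨hwb, fun p hp hpb => h.hullUnion_disjoint hab h1
        (h.hullUnion_of_hullUnion hba hwb hp hwv hpb)⟩
    · exact .inr ⟨hwb, hw, fun p hp => h.hullUnion_of_not_hullUnion hab hwb hwv hp h1⟩
  · exact .inl ⟨h3 w hvw, fun p hp hpb =>
      h2 (h.hullUnion_of_hullUnion hba (h3 w hvw) hp hwv hpb)⟩

theorem not_hullColor (h : IsNoncrossingFlip f F ι) {a b v w : V} (hab : Linked F ι a b)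
    (hvw : F v w) (hv : HullColor f F ι a b v) : ¬ HullColor f F ι b a v := by
  rintro (⟨h1, h2⟩ | ⟨h1, h2, h3⟩) <;> rcases hv with ⟨h4, h5⟩ | ⟨h4, h5, h6⟩
  · exact h.hullUnion_disjoint hab h4 h1
  · exact h5 h1
  · exact h2 h4
  · exact h.hullUnion_disjoint hab (h3 w hvw) (h6 w hvw)

theorem hullColor_self (h : IsNoncrossingFlip f F ι) {a b : V} (hab : Linked F ι a b) :
    HullColor f F ι a b a :=
  .inl ⟨⟨a, .refl, .inl rfl⟩, fun _ hp hpa =>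
    h.hullUnion_disjoint hab hpa (h.hullUnion_of_adj hab .refl hp)⟩

/-- A noncrossing flip with a link excludes connectedness by even walks. -/
theorem not_evenReach (h : IsNoncrossingFlip f F ι) {a b : V} (hab : Linked F ι a b) :
    ∃ u v, ¬ EvenReach F u v := by
  obtain ⟨c, hc⟩ := Linked.exists_adj h hab
  exact ⟨a, c, EvenReach.not_of_coloring (F := F) (h.hullColor_of_adj hab)
    (h.hullColor_of_adj (h.linked_symm hab)) (h.not_hullColor hab) h.symm
    (h.hullColor_self hab) hc⟩

end IsNoncrossingFlip

/-- A flip of an arc relation that is connected by even walks distinguishes no points. -/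
theorem IsFlip.adj_iff {V : Type*} {f : V → ℕ} {F : V → V → Prop} {ι : V → V}
    (h : IsArcRelation f F) (hι : IsFlip F ι) (hE : ∀ u v, EvenReach F u v) (u v : V) :
    F (ι u) v ↔ F u v := by
  by_cases nc : ∀ {v w}, F v w → ¬ Cross (f v) (f (ι v)) (f w) (f (ι w))
  · by_contra hl
    have hL : Linked F ι u v := by rw [hι.adj] at hl; unfold Linked; tauto
    obtain ⟨x, y, hxy⟩ := IsNoncrossingFlip.not_evenReach ⟨h, hι, nc⟩ hL
    exact (hxy (hE x y)).elim
  · exfalso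
    push Not at nc
    obtain ⟨x, y, hxy, hc⟩ := nc
    let Cw : V → V → Prop := fun v w =>
      Cyc (f v) (f w) (f (ι v)) ∧ Cyc (f (ι v)) (f (ι w)) (f v)
    let red : V → Prop := fun v => ∃ w, F v w ∧ Cw v w
    let blue : V → Prop := fun v => ∃ w, F v w ∧ Cw v (ι w)
    have flip : ∀ {u v}, F u v → F (ι u) (ι v) := fun {u v} e => by rwa [hι.adj, hι.invol]
    have all : ∀ {v w w'}, F v w → F v w' → Cw v w → Cw v w' := by
      intro v w w' hw hw' hc
      have n1 := h.arc hw hw' (h.irrefl v) fun e => hι.not_adj v (h.symm e)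
      have n2 := h.arc (flip hw) (flip hw') (hι.not_adj v) (h.irrefl (ι v))
      have e1 := h.pos_ne hw' (h.irrefl v)
      have e2 := h.pos_ne hw' fun e => hι.not_adj v (h.symm e)
      have e3 := h.pos_ne (flip hw') (hι.not_adj v)
      have e4 := h.pos_ne (flip hw') (h.irrefl (ι v))
      simp only [Cw] at *
      unfold Cyc Cross at *; omega
    have all' : ∀ {v w w'}, F v w → F v w' → Cw v (ι w) → Cw v (ι w') := by
      intro v w w' hw hw' hc
      have n1 := h.arc hw hw' (h.irrefl v) fun e => hι.not_adj v (h.symm e)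
      have n2 := h.arc (flip hw) (flip hw') (hι.not_adj v) (h.irrefl (ι v))
      have e1 := h.pos_ne hw' (h.irrefl v)
      have e2 := h.pos_ne hw' fun e => hι.not_adj v (h.symm e)
      have e3 := h.pos_ne (flip hw') (hι.not_adj v)
      have e4 := h.pos_ne (flip hw') (h.irrefl (ι v))
      simp only [Cw, hι.invol] at *
      unfold Cyc Cross at *; omega
    have rot : ∀ {v w}, Cw v w → Cw w (ι v) := by
      intro v w hc
      simp only [Cw, hι.invol] at *
      unfold Cyc at *; omega
    have rot' : ∀ {v w}, Cw v (ι w) → Cw w v := by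
      intro v w hc
      simp only [Cw, hι.invol] at *
      unfold Cyc at *; omega
    have rb : ∀ {v w}, red v → F v w → blue w := by
      rintro v w ⟨z, hz, hc⟩ hw
      exact ⟨v, h.symm hw, rot (all hz hw hc)⟩
    have br : ∀ {v w}, blue v → F v w → red w := by
      rintro v w ⟨z, hz, hc⟩ hw
      exact ⟨v, h.symm hw, rot' (all' hz hw hc)⟩
    have disj : ∀ {v w}, F v w → red v → ¬ blue v := by
      rintro v - - ⟨w, hw, hc⟩ ⟨w', hw', hc'⟩
      have hc := all hw hw' hc
      simp only [Cw, hι.invol] at *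
      unfold Cyc at *; omega
    have hx : red x ∨ blue x := by
      rcases cross_iff_cyc.1 hc with h1 | h1
      · exact .inl ⟨y, hxy, h1⟩
      · refine .inr ⟨y, hxy, ?_⟩
        simp only [Cw, hι.invol]
        exact h1
    rcases hx with hx | hx
    · exact EvenReach.not_of_coloring (F := F) rb br disj h.symm hx hxy (hE x y)
    · exact EvenReach.not_of_coloring (F := F) br rb
        (fun hx h1 h2 => disj hx h2 h1) h.symm hx hxy (hE x y)

/-- `F (ψ u) v ↔ F u (ψ v)`, and `ψ` moves no point to a neighbour. -/
structure IsTwist {V : Type*} (F : V → V → Prop) (ψ : Equiv.Perm V) : Prop where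
  adj : ∀ {u v}, F (ψ u) v ↔ F u (ψ v)
  not_adj : ∀ u, ¬ F (ψ u) u

namespace IsTwist

variable {V : Type*} {f : V → ℕ} {F : V → V → Prop} {ψ : Equiv.Perm V}

theorem adj_symm (hψ : IsTwist F ψ) {u v : V} : F (ψ u) (ψ.symm v) ↔ F u v := by
  rw [hψ.adj, Equiv.apply_symm_apply]

theorem adj_pow (hψ : IsTwist F ψ) (n : ℕ) {u v : V} : F ((ψ ^ n) u) v ↔ F u ((ψ ^ n) v) := by
  induction n generalizing u v with
  | zero => rfl
  | succ n ih => rw [pow_succ, Equiv.Perm.mul_apply, ih, hψ.adj, ← Equiv.Perm.mul_apply,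
      ← pow_succ', pow_succ]

theorem sq (hF : ∀ u, ¬ F u u) (hψ : IsTwist F ψ) : IsTwist F (ψ ^ 2) where
  adj := hψ.adj_pow 2
  not_adj u := by
    rw [pow_two, Equiv.Perm.mul_apply, hψ.adj]
    exact hF _

theorem pow_odd (hψ : IsTwist F ψ) {m : ℕ} (hm : Odd m) : IsTwist F (ψ ^ m) where
  adj := hψ.adj_pow m
  not_adj u := by
    obtain ⟨q, rfl⟩ := hm
    rw [two_mul, add_assoc, pow_add, Equiv.Perm.mul_apply, hψ.adj_pow, pow_succ',
      Equiv.Perm.mul_apply]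
    exact hψ.not_adj _

/-- A twist whose square distinguishes no points distinguishes no points, if the relation is
connected by even walks. -/
theorem adj_iff_of_sq [Finite V] (h : IsArcRelation f F) (hE : ∀ u v, EvenReach F u v)
    (hψ : IsTwist F ψ) (h2 : ∀ u v, F (ψ (ψ u)) v ↔ F u v) (u v : V) :
    F (ψ u) v ↔ F u v := by
  classical
  have := Fintype.ofFinite V
  obtain ⟨e⟩ : Nonempty ((V → Prop) ↪ ℕ) :=
    ⟨(Fintype.equivFin (V → Prop)).toEmbedding.trans Fin.valEmbedding⟩
  let r : V → ℕ := fun u => e (F u)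
  have r_eq : ∀ {u v}, r u = r v ↔ F u = F v := fun {u v} => e.injective.eq_iff
  have r_sq : ∀ u, r (ψ (ψ u)) = r u := fun u => r_eq.2 (funext fun v => propext (h2 u v))
  have r_map : ∀ {u v}, r u = r v → r (ψ u) = r (ψ v) := by
    intro u v huv
    refine r_eq.2 (funext fun w => propext ?_)
    rw [hψ.adj, hψ.adj, r_eq.1 huv]
  have r_inv : ∀ u, r (ψ.symm u) = r (ψ u) := by
    intro u
    simpa using (r_sq (ψ.symm u)).symm
  let ι : V → V := fun u =>
    if r u = r (ψ u) then u else if r u < r (ψ u) then ψ u else ψ.symm u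
  have r_ι : ∀ u, r (ι u) = r (ψ u) := by
    intro u
    simp only [ι]
    split_ifs with h1 h2
    exacts [h1, rfl, r_inv u]
  have F_ι : ∀ u, F (ι u) = F (ψ u) := fun u => r_eq.1 (r_ι u)
  have adj : ∀ {u v}, F (ι u) v ↔ F u (ι v) := by
    intro u v
    have h1 : F u (ι v) ↔ F (ι v) u := ⟨h.symm, h.symm⟩
    have h3 : F v (ψ u) ↔ F (ψ u) v := ⟨h.symm, h.symm⟩
    rw [h1, F_ι, F_ι, ← h3, hψ.adj]
  have invol : ∀ u, ι (ι u) = u := by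
    intro u
    have k1 : r (ψ (ι u)) = r u := (r_map (r_ι u)).trans (r_sq u)
    have k2 := r_ι u
    have k3 : ι (ι u) = if r (ι u) = r (ψ (ι u)) then ι u else
      if r (ι u) < r (ψ (ι u)) then ψ (ι u) else ψ.symm (ι u) := rfl
    rw [k1, k2] at k3
    rw [k3]
    by_cases h1 : r u = r (ψ u)
    · simp [ι, h1]
    · rcases lt_or_gt_of_ne h1 with h2 | h2
      · simp [ι, h1, Ne.symm h1, h2, h2.not_gt]
      · simp [ι, h1, Ne.symm h1, h2, h2.not_gt]
  have := IsFlip.adj_iff h ⟨invol, adj, fun u => by rw [F_ι]; exact hψ.not_adj u⟩ hE u v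
  rwa [F_ι] at this

theorem adj_iff_of_pow [Finite V] (h : IsArcRelation f F) (hE : ∀ u v, EvenReach F u v)
    (k : ℕ) (hψ : IsTwist F ψ) (hk : ψ ^ 2 ^ k = 1) (u v : V) : F (ψ u) v ↔ F u v := by
  induction k generalizing ψ u v with
  | zero =>
    have : ψ = 1 := by simpa using hk
    rw [this]; rfl
  | succ k ih =>
    refine adj_iff_of_sq h hE hψ (fun u v => ?_) u v
    exact ih (hψ.sq h.irrefl) (by rw [← pow_mul, ← pow_succ', hk]) u v

/-- Twisting by `ψ` amounts to a relabelling. -/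
def IsRelabelling (F : V → V → Prop) (ψ : Equiv.Perm V) : Prop :=
  ∃ θ : Equiv.Perm V, ∀ u v, F (ψ u) v ↔ F (θ u) (θ v)

theorem isRelabelling_of_evenReach [Finite V] (h : IsArcRelation f F)
    (hE : ∀ u v, EvenReach F u v) (hψ : IsTwist F ψ) : IsRelabelling F ψ := by
  obtain ⟨k, m, hm, hkm⟩ := Nat.exists_eq_two_pow_mul_odd (orderOf_pos ψ).ne'
  obtain ⟨q, rfl⟩ := id hm
  have key := adj_iff_of_pow h hE k (hψ.pow_odd hm)
    (by rw [← pow_mul, mul_comm, ← hkm, pow_orderOf_eq_one])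
  refine ⟨ψ ^ (q + 1), fun u v => ?_⟩
  rw [← key, ← hψ.adj_pow, ← Equiv.Perm.mul_apply, ← Equiv.Perm.mul_apply, ← pow_add,
    ← pow_succ, show q + 1 + (q + 1) = 2 * q + 1 + 1 by ring]

/-- A proper two-colouring invariant under `ψ` yields a relabelling. -/
theorem isRelabelling_of_coloring (hψ : IsTwist F ψ) (c : V → Prop)
    (hc : ∀ {u v}, F u v → ¬ (c u ↔ c v)) (hcψ : ∀ u, c (ψ u) ↔ c u) : IsRelabelling F ψ := by
  classical
  have hcψ' : ∀ u, c (ψ.symm u) ↔ c u := fun u => by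
    rw [← hcψ, Equiv.apply_symm_apply]
  let θ : Equiv.Perm V :=
    { toFun := fun u => if c u then ψ u else u
      invFun := fun u => if c u then ψ.symm u else u
      left_inv := fun u => by by_cases h : c u <;> simp [h, hcψ]
      right_inv := fun u => by by_cases h : c u <;> simp [h, hcψ'] }
  have hθ : ∀ u, θ u = if c u then ψ u else u := fun _ => rfl
  refine ⟨θ, fun u v => ?_⟩
  rw [hθ, hθ]
  split_ifs with h1 h2 h2
  · exact iff_of_false (fun e => hc e (by rw [hcψ]; tauto))
      (fun e => hc e (by rw [hcψ, hcψ]; tauto))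
  · rfl
  · exact hψ.adj
  · exact iff_of_false (fun e => hc e (by rw [hcψ]; tauto)) (fun e => hc e (by tauto))

theorem evenReach_map (hψ : IsTwist F ψ) {u v : V} (h : EvenReach F u v) :
    EvenReach F (ψ u) (ψ v) := by
  induction h with
  | refl => exact .refl
  | tail _ h ih =>
    obtain ⟨w, h1, h2⟩ := h
    refine .tail ih ⟨ψ.symm w, hψ.adj_symm.2 h1, ?_⟩
    rwa [← hψ.adj, Equiv.apply_symm_apply]

theorem evenReach_symm_map (hψ : IsTwist F ψ) {u v : V} (h : EvenReach F u v) :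
    EvenReach F (ψ.symm u) (ψ.symm v) := by
  induction h with
  | refl => exact .refl
  | tail _ h ih =>
    obtain ⟨w, h1, h2⟩ := h
    refine .tail ih ⟨ψ w, ?_, hψ.adj_symm.2 h2⟩
    rwa [← hψ.adj, Equiv.apply_symm_apply]

theorem evenReach_twist (hψ : IsTwist F ψ) {u v : V} :
    EvenReach (fun u v => F (ψ u) v) u v ↔ EvenReach F u v := by
  constructor
  · intro h
    suffices EvenReach F (ψ u) (ψ v) by simpa using hψ.evenReach_symm_map this
    induction h with
    | refl => exact .refl
    | tail _ h ih =>
      obtain ⟨w, h1, h2⟩ := h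
      exact .tail ih ⟨w, h1, hψ.adj.1 h2⟩
  · intro h
    induction h with
    | refl => exact .refl
    | tail _ h ih =>
      obtain ⟨w, h1, h2⟩ := h
      exact .tail ih ⟨ψ.symm w, hψ.adj_symm.2 h1, by simpa using h2⟩

theorem isArcRelation (h : IsArcRelation f F) (hψ : IsTwist F ψ) :
    IsArcRelation f fun u v => F (ψ u) v where
  inj := h.inj
  symm e := h.symm (hψ.adj.1 e)
  irrefl := hψ.not_adj
  arc := h.arc

theorem inv (hψ : IsTwist F ψ) : IsTwist F ψ⁻¹ where
  adj {u v} := by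
    have := hψ.adj (u := ψ⁻¹ u) (v := ψ⁻¹ v)
    simpa using this.symm
  not_adj u := by
    have := hψ.not_adj (ψ⁻¹ u)
    rw [hψ.adj] at this
    simpa using this

theorem evenReach_pow (hψ : IsTwist F ψ) (n : ℕ) {u v : V} :
    EvenReach F ((ψ ^ n) u) ((ψ ^ n) v) ↔ EvenReach F u v := by
  induction n with
  | zero => rfl
  | succ n ih =>
    rw [pow_succ', Equiv.Perm.mul_apply, Equiv.Perm.mul_apply, ← ih]
    exact ⟨fun h => by simpa using hψ.evenReach_symm_map h, hψ.evenReach_map⟩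

theorem evenReach_zpow (hψ : IsTwist F ψ) (i : ℤ) {u v : V} :
    EvenReach F ((ψ ^ i) u) ((ψ ^ i) v) ↔ EvenReach F u v := by
  rcases Int.eq_nat_or_neg i with ⟨n, rfl | rfl⟩
  · simpa using hψ.evenReach_pow n
  · simpa using hψ.inv.evenReach_pow n

/-- Without odd closed walks, no even walk joins a point to the twist of its neighbour. -/
theorem not_evenReach (h : IsArcRelation f F) (hψ : IsTwist F ψ)
    (hodd : ∀ {u v}, F u v → ¬ EvenReach F u v) {u v : V} (huv : F u v) :
    ¬ EvenReach F (ψ u) v := by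
  intro he
  have h1 : F (ψ u) (ψ.symm v) := hψ.adj_symm.2 huv
  have h2 : EvenReach F (ψ.symm v) u := he.of_adj h.symm h1 (h.symm huv)
  refine hodd huv (hψ.evenReach_twist.1 ?_)
  exact (hψ.isArcRelation h).evenReach_of_odd h1
    (hψ.evenReach_twist.2 (h2.symm h.symm)) v

theorem not_evenReach_pow (h : IsArcRelation f F) (hψ : IsTwist F ψ)
    (hodd : ∀ {u v}, F u v → ¬ EvenReach F u v) {u v : V} (huv : F u v) (n : ℕ) :
    ¬ EvenReach F ((ψ ^ n) u) v := by
  obtain ⟨j, hj⟩ := Nat.even_or_odd' n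
  obtain ⟨s, rfl⟩ := (ψ ^ j).surjective v
  have hts := (hψ.adj_pow j).2 huv
  intro he
  rcases hj with rfl | rfl
  · rw [two_mul, pow_add, Equiv.Perm.mul_apply, hψ.evenReach_pow] at he
    exact hodd hts he
  · rw [two_mul, add_assoc, pow_add, Equiv.Perm.mul_apply, hψ.evenReach_pow, pow_succ',
      Equiv.Perm.mul_apply] at he
    exact hψ.not_evenReach h hodd hts he

theorem not_evenReach_zpow (h : IsArcRelation f F) (hψ : IsTwist F ψ)
    (hodd : ∀ {u v}, F u v → ¬ EvenReach F u v) {u v : V} (huv : F u v) (i : ℤ) :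
    ¬ EvenReach F ((ψ ^ i) u) v := by
  rcases Int.eq_nat_or_neg i with ⟨n, rfl | rfl⟩
  · simpa using hψ.not_evenReach_pow h hodd huv n
  · simpa using hψ.inv.not_evenReach_pow h hodd huv n

/-- Points joined by even walks and powers of the twist. -/
def reachSetoid (hF : ∀ {u v}, F u v → F v u) (hψ : IsTwist F ψ) : Setoid V where
  r u v := ∃ i : ℤ, EvenReach F ((ψ ^ i) u) v
  iseqv :=
    { refl := fun _ => ⟨0, .refl⟩
      symm := by
        rintro u v ⟨i, h⟩
        refine ⟨-i, (hψ.evenReach_zpow i).1 ?_⟩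
        rw [← Equiv.Perm.mul_apply, ← zpow_add, add_neg_cancel]
        exact h.symm hF
      trans := by
        rintro u v w ⟨i, h⟩ ⟨j, h'⟩
        refine ⟨j + i, ?_⟩
        rw [zpow_add, Equiv.Perm.mul_apply]
        exact ((hψ.evenReach_zpow j).2 h).trans h' }

theorem isRelabelling [Finite V] (h : IsArcRelation f F) (hψ : IsTwist F ψ) :
    IsRelabelling F ψ := by
  by_cases hodd : ∃ u v, F u v ∧ EvenReach F u v
  · obtain ⟨u, v, huv, he⟩ := hodd
    have key := h.evenReach_of_odd huv he
    exact hψ.isRelabelling_of_evenReach h fun x y => ((key x).symm h.symm).trans (key y)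
  push Not at hodd
  obtain ⟨e, he⟩ := exists_injective_nat (Quotient (hψ.reachSetoid h.symm))
  let ℓ : V → ℕ := fun u => e (Quotient.mk _ u)
  have ℓ_eq : ∀ {u v}, ℓ u = ℓ v ↔ ∃ i : ℤ, EvenReach F ((ψ ^ i) u) v := fun {u v} =>
    he.eq_iff.trans Quotient.eq
  have ℓ_ne : ∀ {u v}, F u v → ℓ u ≠ ℓ v := fun huv e =>
    let ⟨i, hi⟩ := ℓ_eq.1 e
    hψ.not_evenReach_zpow h (hodd _ _) huv i hi
  have ℓ_adj : ∀ {u v w}, F u v → F u w → ℓ v = ℓ w := fun hv hw =>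
    ℓ_eq.2 ⟨0, .single ⟨_, h.symm hv, hw⟩⟩
  have ℓ_map : ∀ u, ℓ (ψ u) = ℓ u := fun u => (ℓ_eq.2 ⟨1, .refl⟩).symm
  have ℓ_symm : ∀ u, ℓ (ψ.symm u) = ℓ u := fun u => by
    rw [← ℓ_map, Equiv.apply_symm_apply]
  have lt_iff : ∀ {u v}, F u v → ((∃ w, F u w ∧ ℓ u < ℓ w) ↔ ℓ u < ℓ v) := fun {u v} huv =>
    ⟨fun ⟨w, hw, hlt⟩ => ℓ_adj hw huv ▸ hlt, fun hlt => ⟨v, huv, hlt⟩⟩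
  refine hψ.isRelabelling_of_coloring (fun u => ∃ v, F u v ∧ ℓ u < ℓ v) (fun {u v} huv => ?_)
    fun u => ⟨?_, ?_⟩
  · rw [lt_iff huv, lt_iff (h.symm huv)]
    have := ℓ_ne huv
    omega
  · rintro ⟨v, hv, hlt⟩
    exact ⟨ψ v, hψ.adj.1 hv, by rwa [ℓ_map, ← ℓ_map u]⟩
  · rintro ⟨v, hv, hlt⟩
    exact ⟨ψ.symm v, hψ.adj_symm.2 hv, by rwa [ℓ_map, ℓ_symm]⟩

end IsTwist

/-- The non-adjacency relation of a graph whose augmented adjacency matrix has the circular-ones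
property. -/
theorem HasCircularOnes.exists_isArcRelation {V : Type*} {G : SimpleGraph V}
    (hG : HasCircularOnes (fun u v : V => u = v ∨ G.Adj u v)) :
    ∃ f : V → ℕ, IsArcRelation f fun u v => ¬ (u = v ∨ G.Adj u v) := by
  obtain ⟨n, σ, hσ⟩ := hG
  refine ⟨fun v => σ v, fun u v huv => σ.injective (Fin.ext huv), fun {u v} huv => ?_, ?_, ?_⟩
  · rwa [eq_comm, G.adj_comm]
  · simp
  · intro u x y z w hx hy hz hw hc
    obtain ⟨a, l, hal⟩ := hσ u
    simp only [not_not, hal] at hx hy hz hw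
    exact not_cross_of_mod (σ x).2 (σ y).2 hz hw hx hy hc.symm

/-- Chen's theorem: two Γ circular-arc graphs (graphs whose augmented
adjacency matrices have the circular-ones property) are isomorphic if and
only if their augmented adjacency matrices are isomorphic as binary matrices
(via independent row and column permutations). -/
theorem gamma_circular_arc_iso_iff_matrix_iso {V V' : Type*} [Fintype V] [Fintype V']
    (G : SimpleGraph V) (G' : SimpleGraph V')
    (hG : HasCircularOnes (fun u v : V => u = v ∨ G.Adj u v))
    (hG' : HasCircularOnes (fun u v : V' => u = v ∨ G'.Adj u v)) :
    Nonempty (G ≃g G') ↔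
      ∃ (τ π : V ≃ V'), ∀ u v : V,
        (u = v ∨ G.Adj u v) ↔ (τ u = π v ∨ G'.Adj (τ u) (π v)) := by
  constructor
  · rintro ⟨φ⟩
    exact ⟨φ.toEquiv, φ.toEquiv, fun u v =>
      or_congr φ.injective.eq_iff.symm φ.map_adj_iff.symm⟩
  · rintro ⟨τ, π, hτπ⟩
    obtain ⟨f, hf⟩ := hG.exists_isArcRelation
    let ψ : Equiv.Perm V := π.trans τ.symm
    have key : ∀ u v, (ψ u = v ∨ G.Adj (ψ u) v) ↔ (π u = π v ∨ G'.Adj (π u) (π v)) :=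
      fun u v => by simpa [ψ] using hτπ (ψ u) v
    have comm : ∀ u v, (ψ u = v ∨ G.Adj (ψ u) v) ↔ (u = ψ v ∨ G.Adj u (ψ v)) := fun u v => by
      rw [key, eq_comm, G'.adj_comm, ← key, eq_comm, G.adj_comm]
    have hψ : IsTwist (fun u v => ¬ (u = v ∨ G.Adj u v)) ψ :=
      ⟨fun {u v} => not_congr (comm u v), fun u => not_not.2 ((key u u).2 (.inl rfl))⟩
    obtain ⟨θ, hθ⟩ := hψ.isRelabelling hf
    refine ⟨⟨θ.symm.trans π, fun {u v} => ?_⟩⟩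
    have h1 := (key (θ.symm u) (θ.symm v)).symm.trans
      (not_iff_not.1 (hθ (θ.symm u) (θ.symm v)))
    simp only [EmbeddingLike.apply_eq_iff_eq, Equiv.apply_symm_apply] at h1
    simp only [Equiv.trans_apply]
    by_cases huv : u = v
    · subst huv; simp
    · simpa [huv] using h1
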